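/- Let α = 3, β = 4 (so b = 7), N = 7 and T = 1/3. Let M be the 7×7 matrix with entries M_{jk} = ∫_{−1}^{1/3} p̃_j(x) p̃_k(x) (1−x)³(1+x)⁴/(x−7)² dx for 1 ≤ j, k ≤ 7, let B be the 7×7 matrix with entries B_{jk} = ∫_{−1}^{1} (x−7)² p̃_j(x) p̃_k(x) (1−x)³(1+x)⁴/(x−7)² dx, and let Λ = diag(0, 9, 20, 33, 48, 65, 84) (diagonal entries (n−1)(n+7) for n = 1,…,7). Define γ_1 = 7387129/(53·2^{5/2}·3^{3/2}·5^{3/2}·√11·√13), γ_2 = −4796873/(371·2^{9/2}·3^{5/2}·5^{3/2}·√11·√13), γ_3 = −116603·√3/(53·2^{15/2}·√5·√11·√13), γ_4 = −323·√11/(371·2^{9/2}·3^{5/2}·√5·√13), γ_5 = 7429·3^{5/2}/(371·2^{19/2}·5^{3/2}·√11·√13), γ_6 = 77843/(371·2^{15/2}·3^{5/2}·5^{3/2}·√11·√13), γ_7 = −305881/(371·2^{17/2}·3^{5/2}·5^{3/2}·√11·√13), γ_8 = −323/(371·2^{19/2}·3^{5/2}·√5·√11·√13). Then the matrix 𝓛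 = γ_1·I + γ_2·Λ + γ_3·B + γ_4·Λ² + γ_5·(ΛB + BΛ) + γ_6·(BΛ² + Λ²B) + γ_7·ΛBΛ + γ_8·[(Λ³B + BΛ³) − (ΛBΛ² + Λ²BΛ)] commutes with M: 𝓛M = M𝓛. -/

import Mathlib

open Real MeasureTheory

/-- The generalized binomial coefficient `C(r, k) = r (r-1) ⋯ (r-k+1) / k!`. -/
noncomputable def genChoose (r : ℝ) (k : ℕ) : ℝ :=
  (∏ i ∈ Finset.range k, (r - i)) / (Nat.factorial k : ℝ)

/-- The classical Jacobi polynomials, via the explicit formula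
`p_n^{(α,β)}(x) = Σ_{s=0}^n C(n+α, n-s) C(n+β, s) ((x-1)/2)^s ((x+1)/2)^{n-s}`,
which are orthogonal on `(-1,1)` w.r.t. `(1-x)^α (1+x)^β` and normalized by
`p_n^{(α,β)}(1) = C(n+α, n)`. -/
noncomputable def jacobiP (α β : ℝ) (n : ℕ) (x : ℝ) : ℝ :=
  ∑ s ∈ Finset.range (n + 1),
    genChoose ((n : ℝ) + α) (n - s) * genChoose ((n : ℝ) + β) s *
      ((x - 1) / 2) ^ s * ((x + 1) / 2) ^ (n - s)

/-- `b = (β+α)/(β-α)`. -/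
noncomputable def bJac (α β : ℝ) : ℝ := (β + α) / (β - α)

/-- The exceptional Jacobi polynomials (missing degree `0`):
`p̂_n(x) = (b p_{n-1} - p_{n-2})/(2n+β+α-2) - p_{n-1} (x-b)/2` for `n ≥ 1`,
with the conventions `p̂_0 = 0` (and `p_{-1} = 0`, handled by the guard `n = 1`). -/
noncomputable def excJacobi (α β : ℝ) (n : ℕ) (x : ℝ) : ℝ :=
  if n = 0 then 0
  else (bJac α β * jacobiP α β (n - 1) x - (if n = 1 then 0 else jacobiP α β (n - 2) x)) /
        (2 * (n : ℝ) + β + α - 2)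
      - jacobiP α β (n - 1) x * (x - bJac α β) / 2

/-- `‖p̂_n‖²` for `α = 3`, `β = 4` (so `b = 7`). -/
noncomputable def normSqJ (n : ℕ) : ℝ :=
  ∫ x in (-1 : ℝ)..1, (excJacobi 3 4 n x) ^ 2 * (1 - x) ^ 3 * (1 + x) ^ 4 / (x - 7) ^ 2

/-- The orthonormal exceptional Jacobi polynomials `p̃_n = p̂_n / ‖p̂_n‖` for `α = 3`, `β = 4`. -/
noncomputable def pTil (n : ℕ) (x : ℝ) : ℝ := excJacobi 3 4 n x / Real.sqrt (normSqJ n)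

/-- `M_{jk} = ∫_{-1}^{1/3} p̃_j p̃_k (1-x)³(1+x)⁴/(x-7)² dx`, `1 ≤ j,k ≤ 7`. -/
noncomputable def MMat : Matrix (Fin 7) (Fin 7) ℝ := fun j k =>
  ∫ x in (-1 : ℝ)..(1/3 : ℝ),
    pTil ((j : ℕ) + 1) x * pTil ((k : ℕ) + 1) x * (1 - x) ^ 3 * (1 + x) ^ 4 / (x - 7) ^ 2

/-- `B_{jk} = ∫_{-1}^{1} (x-7)² p̃_j p̃_k (1-x)³(1+x)⁴/(x-7)² dx`. -/
noncomputable def BMat : Matrix (Fin 7) (Fin 7) ℝ := fun j k =>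
  ∫ x in (-1 : ℝ)..1,
    (x - 7) ^ 2 * pTil ((j : ℕ) + 1) x * pTil ((k : ℕ) + 1) x *
      (1 - x) ^ 3 * (1 + x) ^ 4 / (x - 7) ^ 2

/-- `Λ = diag(0, 9, 20, 33, 48, 65, 84)`, with entries `(n-1)(n+7)` for `n = 1, …, 7`. -/
noncomputable def LamMat : Matrix (Fin 7) (Fin 7) ℝ :=
  Matrix.diagonal fun i => (((i : ℕ) + 1 : ℝ) - 1) * (((i : ℕ) + 1 : ℝ) + 7)

noncomputable def γ1 : ℝ :=
  7387129 / (53 * (2:ℝ) ^ ((5:ℝ)/2) * (3:ℝ) ^ ((3:ℝ)/2) * (5:ℝ) ^ ((3:ℝ)/2) *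
    Real.sqrt 11 * Real.sqrt 13)
noncomputable def γ2 : ℝ :=
  -4796873 / (371 * (2:ℝ) ^ ((9:ℝ)/2) * (3:ℝ) ^ ((5:ℝ)/2) * (5:ℝ) ^ ((3:ℝ)/2) *
    Real.sqrt 11 * Real.sqrt 13)
noncomputable def γ3 : ℝ :=
  -116603 * Real.sqrt 3 / (53 * (2:ℝ) ^ ((15:ℝ)/2) * Real.sqrt 5 * Real.sqrt 11 * Real.sqrt 13)
noncomputable def γ4 : ℝ :=
  -323 * Real.sqrt 11 / (371 * (2:ℝ) ^ ((9:ℝ)/2) * (3:ℝ) ^ ((5:ℝ)/2) *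
    Real.sqrt 5 * Real.sqrt 13)
noncomputable def γ5 : ℝ :=
  7429 * (3:ℝ) ^ ((5:ℝ)/2) / (371 * (2:ℝ) ^ ((19:ℝ)/2) * (5:ℝ) ^ ((3:ℝ)/2) *
    Real.sqrt 11 * Real.sqrt 13)
noncomputable def γ6 : ℝ :=
  77843 / (371 * (2:ℝ) ^ ((15:ℝ)/2) * (3:ℝ) ^ ((5:ℝ)/2) * (5:ℝ) ^ ((3:ℝ)/2) *
    Real.sqrt 11 * Real.sqrt 13)
noncomputable def γ7 : ℝ :=
  -305881 / (371 * (2:ℝ) ^ ((17:ℝ)/2) * (3:ℝ) ^ ((5:ℝ)/2) * (5:ℝ) ^ ((3:ℝ)/2) *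
    Real.sqrt 11 * Real.sqrt 13)
noncomputable def γ8 : ℝ :=
  -323 / (371 * (2:ℝ) ^ ((19:ℝ)/2) * (3:ℝ) ^ ((5:ℝ)/2) *
    Real.sqrt 5 * Real.sqrt 11 * Real.sqrt 13)

/-- The commuting matrix `𝓛` written as a combination of monomials in `B` and `Λ`. -/
noncomputable def LMat : Matrix (Fin 7) (Fin 7) ℝ :=
  γ1 • (1 : Matrix (Fin 7) (Fin 7) ℝ) + γ2 • LamMat + γ3 • BMat + γ4 • LamMat ^ 2
    + γ5 • (LamMat * BMat + BMat * LamMat)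
    + γ6 • (BMat * LamMat ^ 2 + LamMat ^ 2 * BMat)
    + γ7 • (LamMat * BMat * LamMat)
    + γ8 • ((LamMat ^ 3 * BMat + BMat * LamMat ^ 3)
        - (LamMat * BMat * LamMat ^ 2 + LamMat ^ 2 * BMat * LamMat))

namespace JacobiCommute

/-- Value at `t` of the polynomial with the given list of coefficients, constant term first. -/
def horner {K : Type*} [DivisionRing K] : List ℚ → K → K
  | [], _ => 0
  | a :: l, t => (a : K) + t * horner l t

/-- Sum of coefficient lists. -/
def addCoeffs : List ℚ → List ℚ → List ℚ
  | [], m => m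
  | a :: l, [] => a :: l
  | a :: l, b :: m => (a + b) :: addCoeffs l m

/-- Product of coefficient lists. -/
def mulCoeffs : List ℚ → List ℚ → List ℚ
  | [], _ => []
  | a :: l, m => addCoeffs (m.map (a * ·)) (0 :: mulCoeffs l m)

/-- Coefficient list with `m`-th entry divided by `m + k + 1`. -/
def primCoeffs : ℕ → List ℚ → List ℚ
  | _, [] => []
  | k, a :: l => a / (k + 1) :: primCoeffs (k + 1) l

theorem horner_addCoeffs (l m : List ℚ) (t : ℝ) :
    horner (addCoeffs l m) t = horner l t + horner m t := by
  induction l generalizing m with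
  | nil => simp [addCoeffs, horner]
  | cons a l ih =>
    cases m with
    | nil => simp [addCoeffs, horner]
    | cons b m => simp only [addCoeffs, horner, ih]; push_cast; ring

theorem horner_map_mul (a : ℚ) (l : List ℚ) (t : ℝ) :
    horner (l.map (a * ·)) t = a * horner l t := by
  induction l with
  | nil => simp [horner]
  | cons b l ih => simp only [List.map_cons, horner, ih]; push_cast; ring

theorem horner_mulCoeffs (l m : List ℚ) (t : ℝ) :
    horner (mulCoeffs l m) t = horner l t * horner m t := by
  induction l with
  | nil => simp [mulCoeffs, horner]
  | cons a l ih =>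
    simp only [mulCoeffs, horner, horner_addCoeffs, horner_map_mul, ih]
    push_cast; ring

theorem cast_horner (l : List ℚ) (t : ℚ) : ((horner l t : ℚ) : ℝ) = horner l (t : ℝ) := by
  induction l with
  | nil => simp [horner]
  | cons a l ih => simp only [horner]; push_cast [ih]; rfl

theorem horner_eq_drop_two (l : List ℚ) (t : ℝ) :
    horner l t = (l.headD 0 : ℚ) + t * (l.getD 1 0 : ℚ) + t ^ 2 * horner (l.drop 2) t := by
  match l with
  | [] => simp [horner]
  | [a] => simp [horner]
  | a :: b :: l => simp [horner]; ring

theorem hasDerivAt_horner_primCoeffs (k : ℕ) (l : List ℚ) (t : ℝ) :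
    HasDerivAt (fun t : ℝ => t ^ (k + 1) * horner (primCoeffs k l) t) (t ^ k * horner l t) t := by
  induction l generalizing k with
  | nil => simpa [primCoeffs, horner] using hasDerivAt_const t (0 : ℝ)
  | cons a l ih =>
    have h := ((hasDerivAt_pow (k + 1) t).mul_const ((a : ℝ) / (k + 1))).add (ih (k + 1))
    have hk : (k : ℝ) + 1 ≠ 0 := by positivity
    refine (h.congr_deriv ?_).congr_of_eventuallyEq (.of_forall fun s => ?_)
    · simp only [horner]; push_cast [Nat.add_sub_cancel]; field_simp; ring
    · simp only [primCoeffs, horner, Pi.add_apply]; push_cast; ring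

/-- The integral of `c(t) / t²` from `u` to `v`, for a polynomial `c` without linear term. -/
def integralDivSq (u v : ℚ) (c : List ℚ) : ℚ :=
  (c.headD 0 * (1 / u - 1 / v)) +
    (v * horner (primCoeffs 0 (c.drop 2)) v - u * horner (primCoeffs 0 (c.drop 2)) u)

theorem integral_horner_div_sq {c : List ℚ} (hc : c.getD 1 0 = 0) {u v : ℚ} (huv : u ≤ v)
    (hv : v < 0) {p q : ℝ} (hp : p = u + 7) (hq : q = v + 7) :
    ∫ x in p..q, horner c (x - 7) / (x - 7) ^ 2 = (integralDivSq u v c : ℝ) := by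
  have hpq : p ≤ q := by rw [hp, hq]; gcongr
  have hv' : (v : ℝ) < 0 := by exact_mod_cast hv
  have hq7 : q < 7 := by linarith
  have hne : ∀ x ∈ Set.uIcc p q, x - 7 ≠ 0 := fun x hx => by
    rw [Set.uIcc_of_le hpq] at hx
    exact (by linarith [hx.2] : x - 7 < 0).ne
  set l := c.drop 2
  have hd : ∀ x ∈ Set.uIcc p q,
      HasDerivAt (fun x : ℝ => -(c.headD 0 : ℚ) * (x - 7)⁻¹ +
        (x - 7) ^ (0 + 1) * horner (primCoeffs 0 l) (x - 7))
        ((c.headD 0 : ℚ) / (x - 7) ^ 2 + horner l (x - 7)) x := by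
    intro x hx
    have hx7 := (hasDerivAt_id x).sub_const (7 : ℝ)
    have h1 := ((hx7.inv (hne x hx)).const_mul (-((c.headD 0 : ℚ) : ℝ)))
    have h2 := (hasDerivAt_horner_primCoeffs 0 l (x - 7)).comp x hx7
    refine (h1.add h2).congr_deriv ?_
    simp; ring
  have hcont : Continuous fun t : ℝ => horner l t := by
    induction l with
    | nil => exact continuous_const
    | cons a l ih => exact continuous_const.add (continuous_id.mul ih)
  have hint : ∫ x in p..q, horner c (x - 7) / (x - 7) ^ 2 =
      ∫ x in p..q, ((c.headD 0 : ℚ) : ℝ) / (x - 7) ^ 2 + horner l (x - 7) := by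
    refine intervalIntegral.integral_congr fun x hx => ?_
    have := hne x hx
    simp only [horner_eq_drop_two c, hc]
    push_cast
    field_simp
    ring
  rw [hint, intervalIntegral.integral_eq_sub_of_hasDerivAt hd]
  · subst hp hq
    simp only [integralDivSq]
    push_cast [cast_horner]
    simp [l]
    ring
  · refine ContinuousOn.intervalIntegrable (ContinuousOn.add ?_ ?_)
    · exact continuousOn_const.div (by fun_prop) fun x hx => pow_ne_zero 2 (hne x hx)
    · exact (hcont.comp (continuous_id.sub continuous_const)).continuousOn

/-- Coefficients in powers of `x - 7` of a positive multiple of the exceptional Jacobi polynomial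
of degree `n + 1`. -/
def excCoeffs (n : Fin 7) : List ℚ :=
  match n with
  | 0 => [2, -1]
  | 1 => [32, -16, -3]
  | 2 => [3312, -1656, -690, -55]
  | 3 => [50432, -25216, -17336, -2816, -143]
  | 4 => [964256, -482128, -482128, -119288, -12194, -455]
  | 5 => [2868480, -1434240, -1942200, -648960, -100035, -7488, -221]
  | 6 => [78168704, -39084352, -68397616, -28878440, -5961440, -671024, -39678, -969]

/-- The scalar relating `excCoeffs n` to the exceptional Jacobi polynomial of degree `n + 1`. -/
def excScale (n : Fin 7) : ℚ := ![2, 4/3, 8, 8, 32/3, 16/7, 32/7] n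

/-- Coefficients of `(1 - x)³ (1 + x)⁴` in powers of `x - 7`. -/
def weightCoeffs : List ℚ := [-884736, -884736, -377856, -89344, -12632, -1068, -50, -1]

theorem horner_weightCoeffs (x : ℝ) :
    horner weightCoeffs (x - 7) = (1 - x) ^ 3 * (1 + x) ^ 4 := by
  simp only [weightCoeffs, horner]; push_cast; ring

theorem excScale_pos (n : Fin 7) : 0 < excScale n := by
  fin_cases n <;> norm_num [excScale]

theorem excJacobi_eq_horner (n : Fin 7) (x : ℝ) :
    excJacobi 3 4 (n + 1) x = horner (excCoeffs n) (x - 7) / excScale n := by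
  fin_cases n <;>
  · simp [excJacobi, bJac, jacobiP, genChoose, excCoeffs, excScale, horner,
      Finset.sum_range_succ, Finset.prod_range_succ, Nat.factorial]
    ring

/-- Coefficients of the product of two exceptional polynomials and the weight. -/
def prodCoeffs (j k : Fin 7) : List ℚ :=
  mulCoeffs weightCoeffs (mulCoeffs (excCoeffs j) (excCoeffs k))

theorem prodCoeffs_getD_one (j k : Fin 7) : (prodCoeffs j k).getD 1 0 = 0 := by
  revert j k; decide +kernel

theorem horner_prodCoeffs (j k : Fin 7) (x : ℝ) : horner (prodCoeffs j k) (x - 7) =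
    horner (excCoeffs j) (x - 7) * horner (excCoeffs k) (x - 7) * (1 - x) ^ 3 * (1 + x) ^ 4 := by
  rw [prodCoeffs, horner_mulCoeffs, horner_mulCoeffs, horner_weightCoeffs]; ring

/-- Squared norms of the polynomials `excCoeffs`. -/
def normSqQ (j : Fin 7) : ℚ := ![32/21, 128/105, 512/9, 4096/63, 4096/33, 4096/693, 32768/1365] j

theorem normSqQ_pos (j : Fin 7) : 0 < normSqQ j := by
  fin_cases j <;> norm_num [normSqQ]

theorem integralDivSq_prodCoeffs_self (j : Fin 7) :
    integralDivSq (-8) (-6) (prodCoeffs j j) = normSqQ j := by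
  revert j; decide +kernel

/-- Entries of `MMat` before normalization. -/
def mEntry (j k : Fin 7) : ℚ :=
  !![257024/229635, -131072/295245, -499712/295245, 262144/885735, 13549568/7971615,
     262144/1594323, -6356992/18600435;
     -131072/295245, 1409024/2066715, -262144/98415, -1835008/2657205, 8388608/7971615,
     262144/1240029, -2097152/23914845;
     -499712/295245, -262144/98415, 291045376/7971615, -130023424/7971615, -214040576/23914845,
     20971520/43046721, 173539328/71744535;
     262144/885735, -1835008/2657205, -130023424/7971615, 6633291776/167403915,
     -6295650304/215233605, -98566144/43046721, 570425344/215233605;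
     13549568/7971615, 8388608/7971615, -214040576/23914845, -6295650304/215233605,
     58455228416/789189885, -1002438656/129140163, -25921847296/5811307335;
     262144/1594323, 262144/1240029, 20971520/43046721, -98566144/43046721,
     -1002438656/129140163, 1000217772032/268482398877, -1375731712/387420489;
     -6356992/18600435, -2097152/23914845, 173539328/71744535, 570425344/215233605,
     -25921847296/5811307335, -1375731712/387420489, 7531304845312/528828967485] j k

theorem integralDivSq_prodCoeffs (j k : Fin 7) :
    integralDivSq (-8) (-20/3) (prodCoeffs j k) = mEntry j k := by
  revert j k; decide +kernel

/-- Entries of `BMat` before normalization. -/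
def bEntry (j k : Fin 7) : ℚ :=
  !![22784/315, -4096/693, 512/495, 0, 0, 0, 0;
     -4096/693, 203776/3465, -57344/1287, 4096/3003, 0, 0, 0;
     512/495, -57344/1287, 41549824/15015, -458752/1287, 4096/273, 0, 0;
     0, 4096/3003, -458752/1287, 1445888/455, -1835008/3315, 4096/1071, 0;
     0, 0, 4096/273, -1835008/3315, 358449152/58905, -1835008/10659, 32768/2907;
     0, 0, 0, 4096/1071, -1835008/10659, 108326912/373065, -524288/6783;
     0, 0, 0, 0, 32768/2907, -524288/6783, 1010827264/855855] j k

theorem integralDivSq_zero_zero_prodCoeffs (j k : Fin 7) :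
    integralDivSq (-8) (-6) (0 :: 0 :: prodCoeffs j k) = bEntry j k := by
  revert j k; decide +kernel

theorem normSqJ_eq (j : Fin 7) : normSqJ (j + 1) = normSqQ j / (excScale j : ℝ) ^ 2 := by
  rw [← integralDivSq_prodCoeffs_self,
    ← integral_horner_div_sq (prodCoeffs_getD_one j j) (p := -1) (q := 1) (by norm_num)
      (by norm_num) (by norm_num) (by norm_num), normSqJ, ← intervalIntegral.integral_div]
  congr 1; ext x
  rw [excJacobi_eq_horner, horner_prodCoeffs]
  ring

theorem pTil_eq (j : Fin 7) (x : ℝ) :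
    pTil (j + 1) x = horner (excCoeffs j) (x - 7) / √(normSqQ j) := by
  have hs : (0 : ℝ) < excScale j := by exact_mod_cast excScale_pos j
  have hn : (0 : ℝ) < normSqQ j := by exact_mod_cast normSqQ_pos j
  rw [pTil, normSqJ_eq, excJacobi_eq_horner, Real.sqrt_div hn.le, Real.sqrt_sq hs.le]
  have := Real.sqrt_pos.2 hn
  field_simp

theorem MMat_apply (j k : Fin 7) :
    MMat j k = mEntry j k / (√(normSqQ j) * √(normSqQ k)) := by
  rw [← integralDivSq_prodCoeffs,
      ← integral_horner_div_sq (prodCoeffs_getD_one j k) (p := -1) (q := 1/3)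
      (by norm_num) (by norm_num) (by norm_num) (by norm_num), MMat,
      ← intervalIntegral.integral_div]
  congr 1; ext x
  rw [pTil_eq, pTil_eq, horner_prodCoeffs]
  ring

theorem BMat_apply (j k : Fin 7) :
    BMat j k = bEntry j k / (√(normSqQ j) * √(normSqQ k)) := by
  rw [← integralDivSq_zero_zero_prodCoeffs,
      ← integral_horner_div_sq (c := 0 :: 0 :: prodCoeffs j k) rfl (p := -1) (q := 1)
      (by norm_num) (by norm_num) (by norm_num) (by norm_num), BMat,
      ← intervalIntegral.integral_div]
  congr 1; ext x
  rw [pTil_eq, pTil_eq]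
  simp only [horner, horner_prodCoeffs]
  push_cast
  ring

/-- Diagonal entries of `LamMat`. -/
def lamEntry (i : Fin 7) : ℚ := (i : ℕ) * ((i : ℕ) + 8)

theorem LamMat_eq : LamMat = Matrix.diagonal fun i => (lamEntry i : ℝ) := by
  rw [LamMat]; congr 1; ext i; simp only [lamEntry]; push_cast; ring

/-- Entries of `√4290 • LMat` before normalization. -/
def lEntry (i j : Fin 7) : ℚ :=
  (if i = j then normSqQ i * (7387129 / 3180 - 4796873 / 267120 * lamEntry i
    - 3553 / 53424 * lamEntry i ^ 2) else 0) +
  bEntry i j * (-349809 / 6784 + 200583 / 949760 * (lamEntry i + lamEntry j)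
    + 77843 / 2136960 * (lamEntry i ^ 2 + lamEntry j ^ 2)
    - 305881 / 4273920 * (lamEntry i * lamEntry j)
    - 323 / 1709568 * (lamEntry i ^ 3 + lamEntry j ^ 3
      - (lamEntry i * lamEntry j ^ 2 + lamEntry i ^ 2 * lamEntry j)))

theorem lEntry_mEntry_comm (i k : Fin 7) :
    ∑ j, lEntry i j * mEntry j k / normSqQ j = ∑ j, mEntry i j * lEntry j k / normSqQ j := by
  revert i k; decide +kernel

theorem rpow_div_two {x : ℝ} (hx : 0 < x) (k : ℕ) {r : ℝ} (hr : r = 2 * k + 1) :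
    x ^ (r / 2) = x ^ k * √x := by
  rw [hr, show (2 * k + 1 : ℝ) / 2 = k + 1 / 2 by ring, Real.rpow_add hx, Real.rpow_natCast,
    Real.sqrt_eq_rpow]

theorem sqrt_4290 : √(4290 : ℝ) = √2 * √3 * √5 * √11 * √13 := by
  rw [show (4290 : ℝ) = 2 * 3 * 5 * 11 * 13 by norm_num]
  simp [Real.sqrt_mul]

theorem gamma_eq :
    γ1 = 7387129 / 3180 / √4290 ∧ γ2 = -4796873 / 267120 / √4290 ∧
    γ3 = -349809 / 6784 / √4290 ∧ γ4 = -3553 / 53424 / √4290 ∧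
    γ5 = 200583 / 949760 / √4290 ∧ γ6 = 77843 / 2136960 / √4290 ∧
    γ7 = -305881 / 4273920 / √4290 ∧ γ8 = -323 / 1709568 / √4290 := by
  have h3 : √(3 : ℝ) ^ 2 = 3 := Real.sq_sqrt (by norm_num)
  have h11 : √(11 : ℝ) ^ 2 = 11 := Real.sq_sqrt (by norm_num)
  simp only [γ1, γ2, γ3, γ4, γ5, γ6, γ7, γ8, sqrt_4290,
    rpow_div_two (x := 2) two_pos 2 (r := 5) (by norm_num),
    rpow_div_two (x := 2) two_pos 4 (r := 9) (by norm_num),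
    rpow_div_two (x := 2) two_pos 7 (r := 15) (by norm_num),
    rpow_div_two (x := 2) two_pos 8 (r := 17) (by norm_num),
    rpow_div_two (x := 2) two_pos 9 (r := 19) (by norm_num),
    rpow_div_two (x := 3) three_pos 1 (r := 3) (by norm_num),
    rpow_div_two (x := 3) three_pos 2 (r := 5) (by norm_num),
    rpow_div_two (x := 5) (by norm_num) 1 (r := 3) (by norm_num)]
  refine ⟨?_, ?_, ?_, ?_, ?_, ?_, ?_, ?_⟩ <;> field_simp <;> norm_num [h3, h11]

theorem LMat_apply (i j : Fin 7) :
    LMat i j = lEntry i j / (√4290 * (√(normSqQ i) * √(normSqQ j))) := by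
  have hsq : √(normSqQ i : ℝ) * √(normSqQ i) = normSqQ i :=
    Real.mul_self_sqrt (by exact_mod_cast (normSqQ_pos i).le)
  obtain ⟨h1, h2, h3, h4, h5, h6, h7, h8⟩ := gamma_eq
  have hentry : LMat i j = (if i = j then γ1 + γ2 * lamEntry i + γ4 * lamEntry i ^ 2 else 0) +
      BMat i j * (γ3 + γ5 * (lamEntry i + lamEntry j) + γ6 * (lamEntry i ^ 2 + lamEntry j ^ 2)
        + γ7 * (lamEntry i * lamEntry j) + γ8 * (lamEntry i ^ 3 + lamEntry j ^ 3
          - (lamEntry i * lamEntry j ^ 2 + lamEntry i ^ 2 * lamEntry j))) := by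
    simp only [LMat, LamMat_eq, Matrix.diagonal_pow, Matrix.add_apply, Matrix.sub_apply,
      Matrix.smul_apply, Matrix.diagonal_mul, Matrix.mul_diagonal, Matrix.one_apply,
      Matrix.diagonal_apply, smul_eq_mul, Pi.pow_apply]
    split_ifs <;> ring
  rw [hentry, BMat_apply, lEntry, h1, h2, h3, h4, h5, h6, h7, h8]
  by_cases hij : i = j
  · subst hij
    simp only [if_true]
    push_cast
    rw [hsq]
    have : (normSqQ i : ℝ) ≠ 0 := by exact_mod_cast (normSqQ_pos i).ne'
    field_simp
    ring
  · simp only [if_neg hij]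
    push_cast
    ring

end JacobiCommute

theorem jacobi_perline_commutes : LMat * MMat = MMat * LMat := by
  ext i k
  have hn (j : Fin 7) : (0 : ℝ) ≤ JacobiCommute.normSqQ j := by
    exact_mod_cast (JacobiCommute.normSqQ_pos j).le
  have key := congrArg (fun q : ℚ => (q : ℝ)) (JacobiCommute.lEntry_mEntry_comm i k)
  push_cast at key
  have hL : (LMat * MMat) i k = (∑ j, (JacobiCommute.lEntry i j : ℝ) * JacobiCommute.mEntry j k /
      JacobiCommute.normSqQ j) /
        (√4290 * (√(JacobiCommute.normSqQ i) * √(JacobiCommute.normSqQ k))) := by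
    rw [Matrix.mul_apply, Finset.sum_div]
    refine Finset.sum_congr rfl fun j _ => ?_
    rw [JacobiCommute.LMat_apply, JacobiCommute.MMat_apply]
    conv_rhs => rw [← Real.mul_self_sqrt (hn j)]
    ring
  have hR : (MMat * LMat) i k = (∑ j, (JacobiCommute.mEntry i j : ℝ) * JacobiCommute.lEntry j k /
      JacobiCommute.normSqQ j) /
        (√4290 * (√(JacobiCommute.normSqQ i) * √(JacobiCommute.normSqQ k))) := by
    rw [Matrix.mul_apply, Finset.sum_div]
    refine Finset.sum_congr rfl fun j _ => ?_
    rw [JacobiCommute.LMat_apply, JacobiCommute.MMat_apply]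
    conv_rhs => rw [← Real.mul_self_sqrt (hn j)]
    ring
  rw [hL, hR, key]
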